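/- Suppose Assumptions 1–4 hold and the inverse demand function p is convex. Define s = inf{q ≥ 0 : p(q) = min_n C_n'(0)} and t = inf{q ≥ 0 : min_n C_n'(q) ≥ p(q) + q·∂₊p(q)}. If ∂₋p(s) < 0, then the efficiency of every Cournot candidate is at least f(∂₊p(t)/∂₋p(s)). -/

import Mathlib

open Finset Set

noncomputable section

/-- Assumption 1: the cost function `C` (with derivative `C'`) is convex, continuous,
nondecreasing on `[0,∞)`, continuously differentiable on `(0,∞)`, has right derivative
`C' 0` at `0`, and `C 0 = 0`. -/
def CostAssumption (C C' : ℝ → ℝ) : Prop :=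
  ConvexOn ℝ (Set.Ici 0) C ∧
  ContinuousOn C (Set.Ici 0) ∧
  MonotoneOn C (Set.Ici 0) ∧
  (∀ x : ℝ, 0 < x → HasDerivAt C (C' x) x) ∧
  ContinuousOn C' (Set.Ioi 0) ∧
  HasDerivWithinAt C (C' 0) (Set.Ici 0) 0 ∧
  C 0 = 0

/-- Assumption 2: the inverse demand function `p` is continuous, nonnegative and
nonincreasing on `[0,∞)`, with `p 0 > 0`; `pr q` is the right derivative of `p`
at every `q ≥ 0` and `pl q` is the left derivative of `p` at every `q > 0`. -/
def DemandAssumption (p pl pr : ℝ → ℝ) : Prop :=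
  ContinuousOn p (Set.Ici 0) ∧
  (∀ q : ℝ, 0 ≤ q → 0 ≤ p q) ∧
  AntitoneOn p (Set.Ici 0) ∧
  0 < p 0 ∧
  HasDerivWithinAt p (pr 0) (Set.Ici 0) 0 ∧
  (∀ q : ℝ, 0 < q → HasDerivWithinAt p (pr q) (Set.Ici q) q) ∧
  (∀ q : ℝ, 0 < q → HasDerivWithinAt p (pl q) (Set.Iic q) q)

/-- The social welfare of the supply vector `x`. -/
def SW {N : ℕ} (C : Fin N → ℝ → ℝ) (p : ℝ → ℝ) (x : Fin N → ℝ) : ℝ :=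
  (∫ q in (0:ℝ)..(∑ n, x n), p q) - ∑ n, C n (x n)

/-- A social optimum: a nonnegative vector maximizing the social welfare. -/
def SocialOptimum {N : ℕ} (C : Fin N → ℝ → ℝ) (p : ℝ → ℝ) (x : Fin N → ℝ) : Prop :=
  (∀ n, 0 ≤ x n) ∧ ∀ y : Fin N → ℝ, (∀ n, 0 ≤ y n) → SW C p y ≤ SW C p x

/-- A Cournot candidate: a nonnegative vector satisfying the first-order necessary
conditions for a Cournot equilibrium. -/
def CournotCandidate {N : ℕ} (C' : Fin N → ℝ → ℝ) (p pl pr : ℝ → ℝ)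
    (x : Fin N → ℝ) : Prop :=
  (∀ n, 0 ≤ x n) ∧
  ∀ n, (0 < x n → C' n (x n) ≤ p (∑ m, x m) + x n * pl (∑ m, x m)) ∧
       p (∑ m, x m) + x n * pr (∑ m, x m) ≤ C' n (x n)

/-- A Cournot equilibrium: each supplier's quantity is a best response. -/
def CournotEquilibrium {N : ℕ} (C : Fin N → ℝ → ℝ) (p : ℝ → ℝ) (x : Fin N → ℝ) : Prop :=
  (∀ n, 0 ≤ x n) ∧
  ∀ n, ∀ z : ℝ, 0 ≤ z →
    z * p (z + ∑ m ∈ Finset.univ.erase n, x m) - C n z ≤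
      x n * p (x n + ∑ m ∈ Finset.univ.erase n, x m) - C n (x n)

/-- A monopoly output: a nonnegative vector maximizing total profit. -/
def MonopolyOutput {N : ℕ} (C : Fin N → ℝ → ℝ) (p : ℝ → ℝ) (x : Fin N → ℝ) : Prop :=
  (∀ n, 0 ≤ x n) ∧
  ∀ y : Fin N → ℝ, (∀ n, 0 ≤ y n) →
    p (∑ n, y n) * (∑ n, y n) - ∑ n, C n (y n) ≤
      p (∑ n, x n) * (∑ n, x n) - ∑ n, C n (x n)

/-- The quantity `φ` appearing in the efficiency bound `f`. -/
def phi (c : ℝ) : ℝ := max ((2 - c + Real.sqrt (c ^ 2 - 4 * c + 12)) / 2) 1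

/-- The efficiency lower bound `f(c̄) = (φ² + 2)/(φ² + 2φ + c̄)`. -/
def fbound (c : ℝ) : ℝ := (phi c ^ 2 + 2) / (phi c ^ 2 + 2 * phi c + c)

lemma phi_ge_one (c : ℝ) : 1 ≤ phi c := le_max_right _ _

lemma fbound_le_one {c : ℝ} (hc : 0 ≤ c) : fbound c ≤ 1 := by
  have h := phi_ge_one c
  unfold fbound
  rw [div_le_one (by positivity)]
  linarith

lemma fbound_nonneg {c : ℝ} (hc : 0 ≤ c) : 0 ≤ fbound c := by
  have h := phi_ge_one c
  unfold fbound
  positivity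

lemma fbound_mul_le {c z : ℝ} (hc : 0 ≤ c) (hz : 1 ≤ z) :
    fbound c * (z ^ 2 + 2 * z + c) ≤ z ^ 2 + 2 := by
  have h := phi_ge_one c
  have hD : 0 < phi c ^ 2 + 2 * phi c + c := by positivity
  unfold fbound
  rw [div_mul_eq_mul_div, div_le_iff₀ hD]
  have key : 0 ≤ (z - phi c) * ((2 * phi c + c - 2) * z - (2 * phi c + 4 - c * phi c)) := by
    have hr : 0 ≤ c ^ 2 - 4 * c + 12 := by nlinarith [sq_nonneg (c - 2)]
    have hsq := Real.sq_sqrt hr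
    have hs0 := Real.sqrt_nonneg (c ^ 2 - 4 * c + 12)
    set r := Real.sqrt (c ^ 2 - 4 * c + 12) with hrdef
    rcases le_total 1 ((2 - c + r) / 2) with h1 | h1
    · have hphi : phi c = (2 - c + r) / 2 := by unfold phi; exact max_eq_left h1
      have e : (z - phi c) * ((2 * phi c + c - 2) * z - (2 * phi c + 4 - c * phi c))
          = r * (z - phi c) ^ 2 := by
        rw [hphi]
        linear_combination ((z - (2 - c + r) / 2) / 2) * hsq
      rw [e]; positivity
    · have hphi : phi c = 1 := by unfold phi; exact max_eq_right h1
      rw [hphi]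
      have hc3 : 3 ≤ c := by
        by_contra hlt
        push Not at hlt
        have : r ≤ c := by linarith
        nlinarith
      apply mul_nonneg <;> nlinarith
  nlinarith [key]

lemma fbound_mul_le' {c a X : ℝ} (hc : 0 ≤ c) (ha : 0 < a) (hX : a ≤ X) :
    fbound c * (X ^ 2 + 2 * X * a + c * a ^ 2) ≤ X ^ 2 + 2 * a ^ 2 := by
  have h := fbound_mul_le (z := X / a) hc (by rwa [one_le_div ha])
  have h2 := mul_le_mul_of_nonneg_right h (sq_nonneg a)
  have e1 : fbound c * ((X / a) ^ 2 + 2 * (X / a) + c) * a ^ 2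
      = fbound c * (X ^ 2 + 2 * X * a + c * a ^ 2) := by field_simp
  have e2 : ((X / a) ^ 2 + 2) * a ^ 2 = X ^ 2 + 2 * a ^ 2 := by field_simp
  rw [e1, e2] at h2
  exact h2

lemma tangent_right {f : ℝ → ℝ} {f' x y : ℝ} (hf : ConvexOn ℝ (Set.Ici 0) f)
    (hx : 0 ≤ x) (hxy : x ≤ y) (hd : HasDerivWithinAt f f' (Set.Ici x) x) :
    f x + f' * (y - x) ≤ f y := by
  rcases hxy.eq_or_lt with rfl | hlt
  · simp
  have h := hf.le_slope_of_hasDerivWithinAt_Ioi (Set.mem_Ici.2 hx)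
    (Set.mem_Ici.2 (hx.trans hxy)) hlt (hd.mono Set.Ioi_subset_Ici_self)
  rw [slope_def_field, le_div_iff₀ (by linarith)] at h
  linarith

lemma tangent_left {f : ℝ → ℝ} {f' x y : ℝ} (hf : ConvexOn ℝ (Set.Ici 0) f)
    (hy : 0 ≤ y) (hxy : y ≤ x) (hd : HasDerivWithinAt f f' (Set.Iic x) x) :
    f x + f' * (y - x) ≤ f y := by
  rcases hxy.eq_or_lt with rfl | hlt
  · simp
  have h := hf.slope_le_of_hasDerivWithinAt_Iio (Set.mem_Ici.2 hy)
    (Set.mem_Ici.2 (hy.trans hxy)) hlt (hd.mono Set.Iio_subset_Iic_self)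
  rw [slope_def_field, div_le_iff₀ (by linarith)] at h
  linarith

lemma left_le_right {f : ℝ → ℝ} {l r x : ℝ} (hf : ConvexOn ℝ (Set.Ici 0) f) (hx : 0 < x)
    (hl : HasDerivWithinAt f l (Set.Iic x) x) (hr : HasDerivWithinAt f r (Set.Ici x) x) :
    l ≤ r := by
  have h := hf.leftDeriv_le_rightDeriv_of_mem_interior (x := x) (by simpa using hx)
  rwa [(hl.mono Set.Iio_subset_Iic_self).derivWithin (uniqueDiffWithinAt_Iio x),
    (hr.mono Set.Ioi_subset_Ici_self).derivWithin (uniqueDiffWithinAt_Ioi x)] at h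

lemma CostAssumption.tangent {C C' : ℝ → ℝ} (h : CostAssumption C C') {x y : ℝ}
    (hx : 0 ≤ x) (hy : 0 ≤ y) : C x + C' x * (y - x) ≤ C y := by
  obtain ⟨hcv, -, -, hd, -, hd0, -⟩ := h
  rcases hx.eq_or_lt with rfl | hx0
  · exact tangent_right hcv le_rfl hy hd0
  · rcases le_total x y with h1 | h1
    · exact tangent_right hcv hx h1 (hd x hx0).hasDerivWithinAt
    · exact tangent_left hcv hy h1 (hd x hx0).hasDerivWithinAt

lemma CostAssumption.mono {C C' : ℝ → ℝ} (h : CostAssumption C C') {x y : ℝ}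
    (hx : 0 ≤ x) (hxy : x ≤ y) : C' x ≤ C' y := by
  rcases hxy.eq_or_lt with rfl | hlt
  · rfl
  have h1 := h.tangent hx (hx.trans hxy)
  have h2 := h.tangent (hx.trans hxy) hx
  nlinarith

lemma int_affine (A B X a b : ℝ) :
    ∫ q in a..b, (A + B * (q - X)) = A * (b - a) + B * ((b - X) ^ 2 - (a - X) ^ 2) / 2 := by
  have hd : ∀ q ∈ Set.uIcc a b, HasDerivAt (fun q : ℝ => A * q + B * (q - X) ^ 2 / 2)
      (A + B * (q - X)) q := by
    intro q _
    have h1 := ((hasDerivAt_id q).const_mul A).add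
      (((((hasDerivAt_id q).sub_const X).pow 2).const_mul B).div_const 2)
    refine h1.congr_deriv ?_
    simp; ring
  rw [intervalIntegral.integral_eq_sub_of_hasDerivAt hd
    ((by fun_prop : Continuous fun q : ℝ => A + B * (q - X)).intervalIntegrable _ _)]
  ring

lemma intble {p : ℝ → ℝ} (hp : ContinuousOn p (Set.Ici 0)) {a b : ℝ} (ha : 0 ≤ a) (hb : 0 ≤ b) :
    IntervalIntegrable p MeasureTheory.volume a b := by
  apply ContinuousOn.intervalIntegrable
  apply hp.mono
  intro q hq
  exact (le_min ha hb).trans hq.1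

lemma int_le_affine {p : ℝ → ℝ} (hp : ContinuousOn p (Set.Ici 0)) {A B X a b : ℝ}
    (ha : 0 ≤ a) (hab : a ≤ b) (h : ∀ q ∈ Set.Icc a b, p q ≤ A + B * (q - X)) :
    ∫ q in a..b, p q ≤ A * (b - a) + B * ((b - X) ^ 2 - (a - X) ^ 2) / 2 := by
  rw [← int_affine]
  exact intervalIntegral.integral_mono_on hab (intble hp ha (ha.trans hab))
    ((by fun_prop : Continuous fun q : ℝ => A + B * (q - X)).intervalIntegrable _ _) h

lemma affine_le_int {p : ℝ → ℝ} (hp : ContinuousOn p (Set.Ici 0)) {A B X a b : ℝ}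
    (ha : 0 ≤ a) (hab : a ≤ b) (h : ∀ q ∈ Set.Icc a b, A + B * (q - X) ≤ p q) :
    A * (b - a) + B * ((b - X) ^ 2 - (a - X) ^ 2) / 2 ≤ ∫ q in a..b, p q := by
  rw [← int_affine]
  exact intervalIntegral.integral_mono_on hab 
    ((by fun_prop : Continuous fun q : ℝ => A + B * (q - X)).intervalIntegrable _ _)
    (intble hp ha (ha.trans hab)) h

/-- Upper bound for the gain in gross surplus. -/
lemma gain_bound {p : ℝ → ℝ} (hpc : ContinuousOn p (Set.Ici 0))
    (hanti : AntitoneOn p (Set.Ici 0)) (hconv : ConvexOn ℝ (Set.Ici 0) p)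
    {s X a σ Y : ℝ} (hσ : 0 < σ) (hX : 0 ≤ X) (hXs : X ≤ s) (ha : 0 ≤ a) (hY : 0 ≤ Y)
    (hps : p s ≤ p X - a)
    (hd : HasDerivWithinAt p (-σ) (Set.Iic s) s) :
    (∫ q in (0:ℝ)..Y, p q) - ∫ q in (0:ℝ)..X, p q ≤ (p X - a) * (Y - X) + a ^ 2 / (2 * σ) := by
  have hs0 : 0 ≤ s := hX.trans hXs
  have hq0 : 0 ≤ a ^ 2 / (2 * σ) := by positivity
  rw [intervalIntegral.integral_interval_sub_left (intble hpc le_rfl hY) (intble hpc le_rfl hX)]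
  have hmid : ∀ Z, X ≤ Z → Z ≤ s →
      ∫ q in X..Z, p q ≤ (p X - a) * (Z - X) + a ^ 2 / (2 * σ) := by
    intro Z hXZ hZs
    have h := int_le_affine (A := p X) (B := -σ) (X := X) hpc hX hXZ (by
      intro q hq
      have hsX := tangent_left hconv hX hXs hd
      rcases hXs.eq_or_lt with he | hlt
      · have : q = X := le_antisymm (by linarith [hq.2]) hq.1
        rw [this]; simp
      have hpos : 0 < s - X := by linarith
      have hc := hconv.2 (Set.mem_Ici.2 hX) (Set.mem_Ici.2 hs0)
        (div_nonneg (by linarith [hq.2]) hpos.le : 0 ≤ (s - q) / (s - X))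
        (div_nonneg (by linarith [hq.1]) hpos.le : 0 ≤ (q - X) / (s - X))
        (by field_simp; ring)
      simp only [smul_eq_mul] at hc
      have e : (s - q) / (s - X) * X + (q - X) / (s - X) * s = q := by field_simp; ring
      rw [e] at hc
      have h2 : (q - X) / (s - X) * p s ≤ (q - X) / (s - X) * (p X - σ * (s - X)) :=
        mul_le_mul_of_nonneg_left (by linarith)
          (div_nonneg (by linarith [hq.1]) hpos.le)
      have e2 : (s - q) / (s - X) * p X + (q - X) / (s - X) * (p X - σ * (s - X))
        = p X + -σ * (q - X) := by field_simp; ring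
      linarith)
    have h3 : a * (Z - X) - σ * (Z - X) ^ 2 / 2 ≤ a ^ 2 / (2 * σ) := by
      rw [le_div_iff₀ (by positivity)]
      nlinarith [sq_nonneg (a - σ * (Z - X))]
    nlinarith
  rcases le_total Y X with h1 | h1
  · rw [intervalIntegral.integral_symm]
    have h := affine_le_int (A := p X) (B := 0) (X := X) hpc hY h1 (by
      intro q hq
      have := hanti (Set.mem_Ici.2 (hY.trans hq.1)) (Set.mem_Ici.2 hX) hq.2
      linarith)
    nlinarith
  · rcases le_total Y s with h2 | h2
    · exact hmid Y h1 h2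
    · rw [← intervalIntegral.integral_add_adjacent_intervals (intble hpc hX hs0)
        (intble hpc hs0 hY)]
      have h := int_le_affine (A := p X - a) (B := 0) (X := X) hpc hs0 h2 (by
        intro q hq
        have := hanti (Set.mem_Ici.2 hs0) (Set.mem_Ici.2 (hs0.trans hq.1)) hq.1
        linarith)
      have := hmid s hXs le_rfl
      nlinarith

set_option maxHeartbeats 2000000 in
/-- Efficiency lower bound `f(∂₊p(t)/∂₋p(s))` for Cournot candidates, where `s` and
`t` are determined by the demand and cost functions. -/
theorem efficiency_bound_st {N : ℕ} (hN : 0 < N)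
    (C C' : Fin N → ℝ → ℝ) (p pl pr : ℝ → ℝ)
    (hC : ∀ n, CostAssumption (C n) (C' n))
    (hp : DemandAssumption p pl pr)
    (hA3 : ∃ R : ℝ, 0 < R ∧ ∀ n, p R ≤ C' n 0)
    (hA4 : ∃ n, C' n 0 < p 0)
    (hconv : ConvexOn ℝ (Set.Ici 0) p)
    (s t : ℝ)
    (hs : s = sInf {q : ℝ | 0 ≤ q ∧ p q = ⨅ n, C' n 0})
    (ht : t = sInf {q : ℝ | 0 ≤ q ∧ p q + q * pr q ≤ ⨅ n, C' n q})
    (hpls : pl s < 0) :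
    ∀ x xS : Fin N → ℝ, CournotCandidate C' p pl pr x →
      SocialOptimum C p xS →
      fbound (pr t / pl s) ≤ SW C p x / SW C p xS := by
  intro x xS hx hxS
  obtain ⟨hpc, hpn, hanti, hp0, hr0, hr, hl⟩ := hp
  obtain ⟨R, hR0, hR⟩ := hA3
  obtain ⟨n0, hn0⟩ := hA4
  have : Nonempty (Fin N) := ⟨n0⟩
  have hrall : ∀ q : ℝ, 0 ≤ q → HasDerivWithinAt p (pr q) (Set.Ici q) q := by
    intro q hq
    rcases hq.eq_or_lt with rfl | h
    · exact hr0
    · exact hr q h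
  have hrneg : ∀ q : ℝ, 0 ≤ q → pr q ≤ 0 := by
    intro q hq
    have h1 := tangent_right hconv hq (by linarith : q ≤ q + 1) (hrall q hq)
    have h2 := hanti (Set.mem_Ici.2 hq) (Set.mem_Ici.2 (by linarith : (0:ℝ) ≤ q + 1))
      (by linarith : q ≤ q + 1)
    linarith
  obtain ⟨m, hm⟩ : ∃ m, m = ⨅ n, C' n 0 := ⟨_, rfl⟩
  have hmle : ∀ n, m ≤ C' n 0 := fun n => hm ▸ ciInf_le (Set.finite_range _).bddBelow n
  have hpR : p R ≤ m := hm ▸ le_ciInf hR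
  have hm0 : m < p 0 := (hmle n0).trans_lt hn0
  -- properties of s
  rw [← hm] at hs
  have hsmem : s ∈ {q : ℝ | 0 ≤ q ∧ p q = m} := by
    rw [hs]
    apply IsClosed.csInf_mem
    · have := hpc.preimage_isClosed_of_isClosed isClosed_Ici (isClosed_singleton (x := m))
      exact this
    · obtain ⟨q, hq, hqm⟩ := intermediate_value_Icc' hR0.le
        (hpc.mono Set.Icc_subset_Ici_self) ⟨hpR, hm0.le⟩
      exact ⟨q, hq.1, hqm⟩
    · exact ⟨0, fun q hq => hq.1⟩
  obtain ⟨hs0, hps⟩ := hsmem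
  have hspos : 0 < s := by
    rcases hs0.eq_or_lt with h | h
    · rw [← h] at hps; linarith
    · exact h
  have hls := hl s hspos
  -- the candidate
  obtain ⟨hx0, hxc⟩ := hx
  obtain ⟨hy0, hyopt⟩ := hxS
  have hoptx := hyopt x hx0
  have hSWx : SW C p x = (∫ q in (0:ℝ)..(∑ n, x n), p q) - ∑ n, C n (x n) := rfl
  have hSWy : SW C p xS = (∫ q in (0:ℝ)..(∑ n, xS n), p q) - ∑ n, C n (xS n) := rfl
  obtain ⟨X, hXdef⟩ : ∃ X, X = ∑ n, x n := ⟨_, rfl⟩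
  obtain ⟨Y, hYdef⟩ : ∃ Y, Y = ∑ n, xS n := ⟨_, rfl⟩
  rw [← hXdef] at hxc hSWx
  rw [← hYdef] at hSWy
  have hY0 : 0 ≤ Y := hYdef ▸ Finset.sum_nonneg fun n _ => hy0 n
  have hxX : ∀ n, x n ≤ X := fun n => hXdef ▸ Finset.single_le_sum (fun i _ => hx0 i) (Finset.mem_univ n)
  obtain ⟨n1, hn1⟩ := Finite.exists_max x
  have hx1 : 0 < x n1 := by
    rcases (hx0 n1).eq_or_lt with h | h
    · exfalso
      have hz : ∀ n, x n = 0 := fun n => le_antisymm ((hn1 n).trans h.ge) (hx0 n)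
      have hX : X = 0 := by rw [hXdef]; exact Finset.sum_eq_zero fun n _ => hz n
      have := (hxc n0).2
      rw [hz, hX] at this
      linarith
    · exact h
  have hX0 : 0 < X := hx1.trans_le (hxX n1)
  have hlX := hl X hX0
  have hlr : pl X = pr X := by
    apply le_antisymm (left_le_right hconv hX0 hlX (hr X hX0))
    have h1 := (hxc n1).1 hx1
    have h2 := (hxc n1).2
    have : x n1 * pr X ≤ x n1 * pl X := by linarith
    exact le_of_mul_le_mul_left this hx1
  rw [hlr] at hlX
  obtain ⟨c, hc⟩ : ∃ c, c = - pr X := ⟨_, rfl⟩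
  have hprX : pr X = -c := by linarith
  rw [hlr, hprX] at hxc
  rw [hprX] at hlX
  have hc0 : 0 ≤ c := by linarith [hrneg X hX0.le]
  -- t ≤ X
  have hX_mem : X ∈ {q : ℝ | 0 ≤ q ∧ p q + q * pr q ≤ ⨅ n, C' n q} := by
    refine ⟨hX0.le, le_ciInf fun n => ?_⟩
    have h1 := (hxc n).2
    have h2 := (hC n).mono (hx0 n) (hxX n)
    rw [hprX]
    nlinarith [hxX n]
  have htX : t ≤ X := ht ▸ csInf_le ⟨0, fun q hq => hq.1⟩ hX_mem
  have ht0 : 0 ≤ t := ht ▸ le_csInf ⟨X, hX_mem⟩ fun q hq => hq.1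
  have hprt : pr t ≤ -c := by
    rcases htX.eq_or_lt with h | h
    · rw [h, hprX]
    · have h1 := tangent_right hconv ht0 htX (hrall t ht0)
      have h2 := tangent_left hconv ht0 htX hlX
      nlinarith
  obtain ⟨σ, hσ⟩ : ∃ σ, σ = - pl s := ⟨_, rfl⟩
  have hσ0 : 0 < σ := by linarith
  have hpls' : pl s = -σ := by linarith
  rw [hpls'] at hls ⊢
  obtain ⟨k, hk⟩ : ∃ k, k = pr t / -σ := ⟨_, rfl⟩
  rw [← hk]
  have hck : c ≤ k * σ := by
    rw [hk]
    have : pr t / -σ * σ = - pr t := by field_simp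
    linarith
  have hk0 : 0 ≤ k := by
    by_contra h
    push Not at h
    nlinarith
  -- cost estimates
  obtain ⟨Q, hQ⟩ : ∃ Q, Q = ∑ n, x n ^ 2 := ⟨_, rfl⟩
  have hQ1 : x n1 ^ 2 ≤ Q :=
    hQ ▸ Finset.single_le_sum (f := fun n => x n ^ 2) (fun i _ => sq_nonneg _) (Finset.mem_univ n1)
  have hcostx : ∑ n, C n (x n) ≤ p X * X - c * Q := by
    rw [hXdef, hQ, Finset.mul_sum, Finset.mul_sum, ← Finset.sum_sub_distrib, ← hXdef]
    refine Finset.sum_le_sum fun n _ => ?_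
    have h0 : C n 0 = 0 := (hC n).2.2.2.2.2.2
    rcases (hx0 n).eq_or_lt with h | h
    · rw [← h, h0]; simp
    · have h1 := (hC n).tangent (hx0 n) le_rfl
      have h2 := mul_le_mul_of_nonneg_right ((hxc n).1 h) h.le
      nlinarith
  have hcosty : ∑ n, C n (x n) + p X * (Y - X) - c * x n1 * Y + c * Q ≤ ∑ n, C n (xS n) := by
    have e : ∑ n, C n (x n) + p X * (Y - X) - c * x n1 * Y + c * Q
        = ∑ n, (C n (x n) + p X * (xS n - x n) - c * x n1 * xS n + c * x n ^ 2) := by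
      simp only [Finset.sum_add_distrib, Finset.sum_sub_distrib, ← Finset.mul_sum]
      rw [← hXdef, ← hYdef, ← hQ]
    rw [e]
    refine Finset.sum_le_sum fun n _ => ?_
    have h1 := (hC n).tangent (hx0 n) (hy0 n)
    have h3 : (p X - c * x n) * (xS n - x n) ≤ C' n (x n) * (xS n - x n) := by
      rcases (hx0 n).eq_or_lt with h | h
      · have h2 := (hxc n).2
        apply mul_le_mul_of_nonneg_right (by linarith)
        linarith [hy0 n]
      · have h2 := (hxc n).2
        have h2' := (hxc n).1 h
        have : C' n (x n) = p X - c * x n := by linarith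
        rw [this]
    have h4 : c * x n * xS n ≤ c * x n1 * xS n :=
      mul_le_mul_of_nonneg_right (mul_le_mul_of_nonneg_left (hn1 n) hc0) (hy0 n)
    linarith
  have hmX : m ≤ p X - c * x n1 := by
    have h1 := (hxc n1).1 hx1
    have h2 := (hC n1).mono le_rfl (hx0 n1)
    have h3 := hmle n1
    linarith
  rcases hc0.eq_or_lt with hcz | hcpos
  · -- zero slope
    have hc' : c = 0 := hcz.symm
    subst hc'
    have hmX' : m ≤ p X := by linarith
    have hpXs : p X ≤ p s := by
      rcases le_total s X with h | h
      · exact hanti (Set.mem_Ici.2 hs0) (Set.mem_Ici.2 hX0.le) h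
      · have := tangent_right hconv hX0.le h (hr X hX0)
        rw [hprX] at this
        linarith
    have hsX : s ≤ X := by
      by_contra h
      push Not at h
      have := tangent_left hconv hX0.le h.le hls
      nlinarith
    have hpX : p X = m := by linarith
    have hint1 := affine_le_int (A := m) (B := -σ) (X := s) hpc le_rfl hs0 (by
      intro q hq
      have := tangent_left hconv hq.1 hq.2 hls
      linarith)
    have hint2 := affine_le_int (A := m) (B := 0) (X := s) hpc hs0 hsX (by
      intro q hq
      have := hanti (Set.mem_Ici.2 (hs0.trans hq.1)) (Set.mem_Ici.2 hX0.le) hq.2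
      linarith)
    have hadd := intervalIntegral.integral_add_adjacent_intervals (intble hpc le_rfl hs0)
        (intble hpc hs0 hX0.le)
    have hpos : 0 < SW C p x := by
      rw [hSWx, ← hadd]
      have : 0 < σ * s ^ 2 := by positivity
      rw [hpX] at hcostx
      nlinarith
    have hle : SW C p xS ≤ SW C p x := by
      have hint : (∫ q in (0:ℝ)..Y, p q) - ∫ q in (0:ℝ)..X, p q ≤ p X * (Y - X) := by
        rw [intervalIntegral.integral_interval_sub_left (intble hpc le_rfl hY0)
          (intble hpc le_rfl hX0.le)]
        rcases le_total X Y with h | h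
        · have h1 := int_le_affine (A := p X) (B := 0) (X := X) hpc hX0.le h (by
            intro q hq
            have := hanti (Set.mem_Ici.2 hX0.le) (Set.mem_Ici.2 (hX0.le.trans hq.1)) hq.1
            linarith)
          linarith
        · rw [intervalIntegral.integral_symm]
          have h1 := affine_le_int (A := p X) (B := 0) (X := X) hpc hY0 h (by
            intro q hq
            have := hanti (Set.mem_Ici.2 (hY0.trans hq.1)) (Set.mem_Ici.2 hX0.le) hq.2
            linarith)
          linarith
      rw [hSWx, hSWy]
      linarith
    have heq : SW C p xS = SW C p x := le_antisymm hle hoptx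
    rw [heq, div_self hpos.ne']
    exact fbound_le_one hk0
  · -- positive slope
    have hXs : X ≤ s := by
      by_contra h
      push Not at h
      have h1 := hanti (Set.mem_Ici.2 hs0) (Set.mem_Ici.2 hX0.le) h.le
      have : 0 < c * x n1 := by positivity
      linarith
    have hint := affine_le_int (A := p X) (B := -c) (X := X) hpc le_rfl hX0.le (by
      intro q hq
      exact tangent_left hconv hq.1 hq.2 hlX)
    have hW : c * (X ^ 2 / 2 + x n1 ^ 2) ≤ SW C p x := by
      rw [hSWx]
      have := mul_le_mul_of_nonneg_left hQ1 hc0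
      linarith
    have hgain := gain_bound (a := c * x n1) hpc hanti hconv hσ0 hX0.le hXs (by positivity) hY0
      (by linarith) hls
    have hq : (c * x n1) ^ 2 / (2 * σ) ≤ c * (k * x n1 ^ 2 / 2) := by
      rw [div_le_iff₀ (by positivity)]
      have : 0 ≤ c * x n1 ^ 2 * (k * σ - c) := mul_nonneg (by positivity) (by linarith)
      linarith
    have hWS : SW C p xS ≤ SW C p x + c * (X * x n1 + k * x n1 ^ 2 / 2 - x n1 ^ 2) := by
      rw [hSWx, hSWy]
      have := mul_le_mul_of_nonneg_left hQ1 hc0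
      linarith
    have hWpos : 0 < SW C p x := lt_of_lt_of_le (by positivity) hW
    rw [le_div_iff₀ (hWpos.trans_le hoptx)]
    have hf := fbound_mul_le' hk0 hx1 (hxX n1)
    have hf0 := fbound_nonneg hk0
    have hf1 := fbound_le_one hk0
    have h1 := mul_le_mul_of_nonneg_left hWS hf0
    have h2 := mul_le_mul_of_nonneg_left hW (by linarith : 0 ≤ 1 - fbound k)
    have h3 := mul_le_mul_of_nonneg_left hf hc0
    linarith

end
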